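/- Let S and R be M×M real symmetric matrices, let N ≤ M be even, and let β₁ < β₂ < … < β_N be distinct indices in {1,…,M}. Define f on a neighborhood of 0 in ℝ^M by f(x) = ∏_{i=1}^{M} (1 − Σ_{m=1}^{M} S_{im} R_{im} x_i x_m)^{−1/2} (each factor is well defined and smooth near x = 0 since at x = 0 each argument equals 1). Then the mixed partial derivative ∂_{x_{β₁}} ⋯ ∂_{x_{β_N}} f evaluated at x = 0 equals Haf[(S∘R)_{(β,β)}], the Hafnian of the N×N submatrix of the Hadamard product S∘R obtained by extracting the rows and columns with indices β₁,…,β_N. (Proposition 2 of the paper: the diagonal entries (1 − XSXR)_{ii} with X = diag(x₁,…,x_M) are exactly 1 − Σ_m S_{im}R_{im} x_i x_m.) -/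

import Mathlib

open Matrix
open scoped Classical in
/-- The Hafnian of an `m × m` matrix: the sum over all partitions of `{1,…,m}` into
unordered pairs (encoded as fixed-point-free involutions `σ`) of the products
`∏ A i (σ i)` over the pairs `{i, σ i}` (each pair counted once, via `i < σ i`). -/
noncomputable def hafnian {R : Type*} [CommSemiring R] {m : ℕ}
    (A : Matrix (Fin m) (Fin m) R) : R :=
  ∑ σ ∈ Finset.univ.filter
      (fun σ : Equiv.Perm (Fin m) => σ * σ = 1 ∧ ∀ i, σ i ≠ i),
    ∏ i ∈ Finset.univ.filter (fun i => i < σ i), A i (σ i)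

open scoped ContDiff Topology

theorem iteratedFDeriv_succ_apply_fderiv {E : Type*} [NormedAddCommGroup E] [NormedSpace ℝ E]
    {f : E → ℝ} {x : E} (hf : ContDiffAt ℝ ω f x) {n : ℕ} (v : Fin (n + 1) → E) :
    iteratedFDeriv ℝ (n + 1) f x v =
      iteratedFDeriv ℝ n (fun y => fderiv ℝ f y (v (Fin.last n))) x (Fin.init v) := by
  have hf' : ContDiffAt ℝ ω (fderiv ℝ f) x := hf.fderiv_right le_top
  have h := (ContinuousLinearMap.apply ℝ ℝ (v (Fin.last n))).iteratedFDeriv_comp_left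
    (hf'.of_le le_top) (le_refl (n : WithTop ℕ∞))
  have h' : (fun y => fderiv ℝ f y (v (Fin.last n))) =
      (ContinuousLinearMap.apply ℝ ℝ (v (Fin.last n))) ∘ fderiv ℝ f := rfl
  rw [iteratedFDeriv_succ_apply_right, h', h]
  rfl

theorem ContDiffAt.fderiv_apply_const {E : Type*} [NormedAddCommGroup E] [NormedSpace ℝ E]
    {f : E → ℝ} {x : E} (hf : ContDiffAt ℝ ω f x) (v : E) :
    ContDiffAt ℝ ω (fun y => fderiv ℝ f y v) x :=
  (hf.fderiv_right le_top).clm_apply contDiffAt_const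

theorem ContDiffAt.eventually_differentiableAt {E : Type*} [NormedAddCommGroup E]
    [NormedSpace ℝ E] {f : E → ℝ} {x : E} (hf : ContDiffAt ℝ ω f x) :
    ∀ᶠ y in 𝓝 x, DifferentiableAt ℝ f y :=
  (hf.eventually (by simp)).mono fun _ hy => hy.differentiableAt (by simp)


theorem fderiv_coord_mul_apply_single {ι : Type*} [Fintype ι] [DecidableEq ι]
    {g : (ι → ℝ) → ℝ} {y : ι → ℝ}
    (hg : DifferentiableAt ℝ g y) (i b : ι) :
    fderiv ℝ (fun x => x i * g x) y (Pi.single b 1) =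
      y i * fderiv ℝ g y (Pi.single b 1) + (if i = b then 1 else 0) * g y := by
  have h := (hasFDerivAt_apply (𝕜 := ℝ) i y).mul hg.hasFDerivAt
  rw [show (fun x : ι → ℝ => x i * g x) = (fun x => x i) * g from rfl, h.fderiv]
  simp [Pi.single_apply, mul_comm]

theorem iteratedFDeriv_coord_mul_eq_zero {ι : Type*} [Fintype ι] [DecidableEq ι]
    {n : ℕ} (β : Fin n → ι) (i : ι) (hi : ∀ k, β k ≠ i)
    {g : (ι → ℝ) → ℝ} (hg : ContDiffAt ℝ ω g 0) :
    iteratedFDeriv ℝ n (fun x => x i * g x) 0 (fun k => Pi.single (β k) 1) = 0 := by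
  induction n generalizing g with
  | zero => simp
  | succ n ih =>
    have hx : ContDiffAt ℝ ω (fun x : ι → ℝ => x i) 0 := contDiffAt_apply ..
    rw [iteratedFDeriv_succ_apply_fderiv (hx.mul hg)]
    have hev : (fun y => fderiv ℝ (fun x : ι → ℝ => x i * g x) y (Pi.single (β (Fin.last n)) 1))
        =ᶠ[𝓝 0] fun y => y i * fderiv ℝ g y (Pi.single (β (Fin.last n)) 1) := by
      filter_upwards [hg.eventually_differentiableAt] with y hy
      rw [fderiv_coord_mul_apply_single hy, if_neg (hi _).symm]
      ring
    rw [(hev.iteratedFDeriv ℝ n).eq_of_nhds]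
    exact ih (fun k => β k.castSucc) (fun k => hi _) (hg.fderiv_apply_const _)

theorem iteratedFDeriv_coord_sq_mul_eq_zero {ι : Type*} [Fintype ι] [DecidableEq ι]
    {n : ℕ} {β : Fin n → ι} (hβ : Function.Injective β)
    (i : ι) {g : (ι → ℝ) → ℝ} (hg : ContDiffAt ℝ ω g 0) :
    iteratedFDeriv ℝ n (fun x => x i * (x i * g x)) 0 (fun k => Pi.single (β k) 1) = 0 := by
  induction n generalizing g with
  | zero => simp
  | succ n ih =>
    have hx : ContDiffAt ℝ ω (fun x : ι → ℝ => x i) 0 := contDiffAt_apply ..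
    have hxg := hx.mul hg
    have hg' := hg.fderiv_apply_const (Pi.single (β (Fin.last n)) 1)
    have hβ' : Function.Injective fun k : Fin n => β k.castSucc :=
      hβ.comp (Fin.castSucc_injective n)
    rw [iteratedFDeriv_succ_apply_fderiv (hx.mul hxg)]
    by_cases hib : i = β (Fin.last n)
    · have hev : (fun y => fderiv ℝ (fun x : ι → ℝ => x i * (x i * g x)) y
          (Pi.single (β (Fin.last n)) 1)) =ᶠ[𝓝 0]
          fun y => y i * (2 * g y + y i * fderiv ℝ g y (Pi.single (β (Fin.last n)) 1)) := by
        filter_upwards [hg.eventually_differentiableAt, hxg.eventually_differentiableAt]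
          with y hy hy'
        rw [fderiv_coord_mul_apply_single hy', fderiv_coord_mul_apply_single hy, if_pos hib]
        ring
      rw [(hev.iteratedFDeriv ℝ n).eq_of_nhds]
      refine iteratedFDeriv_coord_mul_eq_zero (fun k : Fin n => β k.castSucc) i (fun k => ?_)
        ((contDiffAt_const.mul hg).add (hx.mul hg'))
      rw [hib]
      exact hβ.ne (Fin.castSucc_lt_last k).ne
    · have hev : (fun y => fderiv ℝ (fun x : ι → ℝ => x i * (x i * g x)) y
          (Pi.single (β (Fin.last n)) 1)) =ᶠ[𝓝 0]
          fun y => y i * (y i * fderiv ℝ g y (Pi.single (β (Fin.last n)) 1)) := by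
        filter_upwards [hg.eventually_differentiableAt, hxg.eventually_differentiableAt]
          with y hy hy'
        rw [fderiv_coord_mul_apply_single hy', fderiv_coord_mul_apply_single hy, if_neg hib]
        ring
      rw [(hev.iteratedFDeriv ℝ n).eq_of_nhds]
      exact ih hβ' hg'

theorem contDiff_mvPolynomial_eval {ι : Type*} [Fintype ι] (p : MvPolynomial ι ℝ) :
    ContDiff ℝ ω fun x : ι → ℝ => MvPolynomial.eval x p := by
  induction p using MvPolynomial.induction_on with
  | C a => simpa using contDiff_const
  | add p q hp hq => simpa using hp.add hq
  | mul_X p i hp => simpa using hp.mul (contDiff_apply ..)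

theorem fderiv_mvPolynomial_eval_apply_single {ι : Type*} [Fintype ι] [DecidableEq ι]
    (p : MvPolynomial ι ℝ) (x : ι → ℝ) (b : ι) :
    fderiv ℝ (fun x : ι → ℝ => MvPolynomial.eval x p) x (Pi.single b 1) =
      MvPolynomial.eval x (MvPolynomial.pderiv b p) := by
  have hd (p : MvPolynomial ι ℝ) := ((contDiff_mvPolynomial_eval p).differentiable (by simp)) x
  induction p using MvPolynomial.induction_on with
  | C a => simp
  | add p q hp hq => simp [fderiv_fun_add (hd p) (hd q), hp, hq]
  | mul_X p i hp =>
    simp_rw [map_mul, MvPolynomial.eval_X, mul_comm (MvPolynomial.eval _ p)]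
    rw [fderiv_coord_mul_apply_single (hd p), hp, Derivation.leibniz, MvPolynomial.pderiv_X]
    by_cases h : i = b
    · subst h; simp; ring
    · simp [h]

theorem iteratedFDeriv_mvPolynomial_eval_zero {ι : Type*} [Fintype ι] [DecidableEq ι]
    {n : ℕ} {β : Fin n → ι}
    (hβ : Function.Injective β) (p : MvPolynomial ι ℝ) :
    iteratedFDeriv ℝ n (fun x : ι → ℝ => MvPolynomial.eval x p) 0
        (fun k => Pi.single (β k) 1) =
      p.coeff (∑ k, Finsupp.single (β k) 1) := by
  induction n generalizing p with
  | zero => simp [MvPolynomial.constantCoeff_eq]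
  | succ n ih =>
    have hβ' : Function.Injective fun k : Fin n => β k.castSucc :=
      hβ.comp (Fin.castSucc_injective n)
    rw [iteratedFDeriv_succ_apply_fderiv (contDiff_mvPolynomial_eval p).contDiffAt]
    simp_rw [fderiv_mvPolynomial_eval_apply_single]
    have h := ih hβ' (MvPolynomial.pderiv (β (Fin.last n)) p)
    refine h.trans ?_
    have h0 : (∑ k : Fin n, Finsupp.single (β k.castSucc) 1 : ι →₀ ℕ) (β (Fin.last n)) = 0 := by
      simp [hβ.eq_iff, (Fin.castSucc_lt_last _).ne]
    rw [MvPolynomial.coeff_pderiv, h0, Fin.sum_univ_castSucc]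
    simp

theorem iteratedFDeriv_prod_mul_eq_of_coord_sq {ι : Type*} [Fintype ι] [DecidableEq ι]
    {n : ℕ} {β : Fin n → ι} (hβ : Function.Injective β) {F a h : ι → (ι → ℝ) → ℝ}
    (ha : ∀ i, ContDiffAt ℝ ω (a i) 0) (hh : ∀ i, ContDiffAt ℝ ω (h i) 0)
    (hF : ∀ i, F i =ᶠ[𝓝 0] fun x => a i x + x i * (x i * h i x)) (T : Finset ι)
    {G : (ι → ℝ) → ℝ} (hG : ContDiffAt ℝ ω G 0) :
    iteratedFDeriv ℝ n (fun x => (∏ i ∈ T, F i x) * G x) 0 (fun k => Pi.single (β k) 1) =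
      iteratedFDeriv ℝ n (fun x => (∏ i ∈ T, a i x) * G x) 0 (fun k => Pi.single (β k) 1) := by
  induction T using Finset.induction_on generalizing G with
  | empty => simp
  | insert i T hi ih =>
    have hx : ContDiffAt ℝ ω (fun x : ι → ℝ => x i) 0 := contDiffAt_apply ..
    have hFi : ContDiffAt ℝ ω (F i) 0 :=
      ((ha i).add (hx.mul (hx.mul (hh i)))).congr_of_eventuallyEq (hF i)
    have hK : ContDiffAt ℝ ω (fun x => (∏ j ∈ T, a j x) * G x) 0 :=
      (contDiffAt_prod fun j _ => ha j).mul hG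
    simp_rw [Finset.prod_insert hi, mul_comm (F i _), mul_assoc]
    rw [ih (hFi.mul hG)]
    have hev : (fun x => (∏ j ∈ T, a j x) * (F i x * G x)) =ᶠ[𝓝 0]
        fun x => a i x * ((∏ j ∈ T, a j x) * G x) +
          x i * (x i * (h i x * ((∏ j ∈ T, a j x) * G x))) := by
      filter_upwards [hF i] with x hx
      rw [hx]
      ring
    rw [(hev.iteratedFDeriv ℝ n).eq_of_nhds,
      fun_iteratedFDeriv_add_apply (((ha i).mul hK).of_le le_top)
        ((hx.mul (hx.mul ((hh i).mul hK))).of_le le_top),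
      _root_.add_apply,
      iteratedFDeriv_coord_sq_mul_eq_zero hβ i ((hh i).mul hK), add_zero]

theorem one_sub_rpow_neg_half_eq {u : ℝ} (hu : u < 1) :
    (1 - u) ^ (-(1 : ℝ) / 2) =
      1 + u / 2 + u ^ 2 * ((2 + √(1 - u)) / (2 * √(1 - u) * (1 + √(1 - u)) ^ 2)) := by
  have h1 : 0 < 1 - u := by linarith
  have hs := Real.sqrt_pos.2 h1
  rw [neg_div, Real.rpow_neg h1.le, ← Real.sqrt_eq_rpow]
  obtain ⟨s, hsdef⟩ : ∃ s, s = √(1 - u) := ⟨_, rfl⟩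
  have hu' : u = 1 - s ^ 2 := by rw [hsdef, Real.sq_sqrt h1.le]; ring
  rw [← hsdef] at hs ⊢
  rw [hu']
  field_simp
  ring

theorem Equiv.Perm.apply_apply_of_mul_self {α : Type*} {σ : Equiv.Perm α} (h : σ * σ = 1) (i : α) :
    σ (σ i) = i := by
  rw [← Equiv.Perm.mul_apply, h, Equiv.Perm.one_apply]

theorem sum_prod_transversal {m : ℕ} {A : Matrix (Fin m) (Fin m) ℝ} (hA : Aᵀ = A)
    {σ : Equiv.Perm (Fin m)} (hσ : σ * σ = 1) (hfix : ∀ i, σ i ≠ i) :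
    ∑ I : Finset (Fin m) with ∀ k, k ∈ I ↔ σ k ∉ I, ∏ k ∈ I, (A k (σ k) / 2) =
      ∏ i with i < σ i, A i (σ i) := by
  have hs := Equiv.Perm.apply_apply_of_mul_self hσ
  have hsym (i j) : A i j = A j i := congrFun₂ hA j i
  set K : Finset (Fin m) := Finset.univ.filter fun i => i < σ i with hK
  have hKσ (k) : σ k ∈ K ↔ k ∉ K := by
    simp only [hK, Finset.mem_filter, Finset.mem_univ, true_and, hs]
    have := hfix k
    grind
  have h1 : ∏ i ∈ K, A i (σ i) = ∏ i ∈ K, (A i (σ i) / 2 + A i (σ i) / 2) := by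
    simp
  rw [h1, Finset.prod_add]
  refine Finset.sum_bij' (fun I _ => I ∩ K)
    (fun T _ => Finset.univ.filter fun k => (k ∈ K ∧ k ∈ T) ∨ (k ∉ K ∧ σ k ∉ T)) ?_ ?_ ?_ ?_ ?_
  · simp
  · intro T hT
    rw [Finset.mem_powerset] at hT
    simp only [Finset.mem_filter, Finset.mem_univ, true_and, hs, hKσ]
    intro k
    tauto
  · intro I hI
    simp only [Finset.mem_filter, Finset.mem_univ, true_and] at hI
    ext k
    have := hI k
    have := hKσ k
    simp only [Finset.mem_filter, Finset.mem_univ, true_and, Finset.mem_inter]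
    tauto
  · intro T hT
    rw [Finset.mem_powerset] at hT
    ext k
    have := @hT k
    simp only [Finset.mem_filter, Finset.mem_univ, true_and, Finset.mem_inter]
    tauto
  · intro I hI
    simp only [Finset.mem_filter, Finset.mem_univ, true_and] at hI
    rw [← Finset.prod_inter_mul_prod_sdiff I K]
    congr 1
    refine Finset.prod_bij' (fun k _ => σ k) (fun k _ => σ k) ?_ ?_ ?_ ?_ ?_
    · intro k hk
      have := hI k
      have := hKσ k
      simp only [Finset.mem_sdiff, Finset.mem_inter] at hk ⊢
      tauto
    · intro k hk
      have := hI k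
      have := hKσ k
      simp only [Finset.mem_sdiff, Finset.mem_inter] at hk ⊢
      tauto
    · simp [hs]
    · simp [hs]
    · intro k _
      rw [hs, hsym]

theorem exists_perm_of_sum_single_eq {α : Type*} [Fintype α] [DecidableEq α]
    {I : Finset α} {f : α → α}
    (h : ∑ k ∈ I, (Finsupp.single k 1 + Finsupp.single (f k) 1) =
      (∑ k, Finsupp.single k 1 : α →₀ ℕ)) :
    ∃ σ : Equiv.Perm α, σ * σ = 1 ∧ (∀ i, σ i ≠ i) ∧ (∀ k, k ∈ I ↔ σ k ∉ I) ∧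
      ∀ k ∈ I, σ k = f k := by
  have hcount (a : α) : (if a ∈ I then 1 else 0) + (I.filter fun k => f k = a).card = 1 := by
    have := DFunLike.congr_fun h a
    rw [Finset.sum_add_distrib] at this
    simp only [Finsupp.add_apply, Finsupp.finsetSum_apply, Finsupp.single_apply,
      Finset.sum_ite_eq', Finset.mem_univ, if_true] at this
    rwa [Finset.card_filter]
  have hfI (k) (hk : k ∈ I) : f k ∉ I := by
    intro hfk
    have := hcount (f k)
    rw [if_pos hfk] at this
    have h0 : (I.filter fun j => f j = f k).card = 0 := by omega
    rw [Finset.card_eq_zero, Finset.filter_eq_empty_iff] at h0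
    exact h0 hk rfl
  have hex (a) (ha : a ∉ I) : ∃ k ∈ I, f k = a ∧ ∀ j ∈ I, f j = a → j = k := by
    have := hcount a
    rw [if_neg ha, zero_add, Finset.card_eq_one] at this
    obtain ⟨k, hk⟩ := this
    have h1 (j) : j ∈ I ∧ f j = a ↔ j = k := by
      have := Finset.ext_iff.1 hk j
      rwa [Finset.mem_filter, Finset.mem_singleton] at this
    exact ⟨k, ((h1 k).2 rfl).1, ((h1 k).2 rfl).2, fun j hj hj' => (h1 j).1 ⟨hj, hj'⟩⟩
  choose! g hgI hg hguniq using hex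
  let s : α → α := fun k => if k ∈ I then f k else g k
  have hs : Function.Involutive s := by
    intro k
    by_cases hk : k ∈ I
    · simp only [s, if_pos hk, if_neg (hfI k hk)]
      exact (hguniq _ (hfI k hk) k hk rfl).symm
    · simp only [s, if_neg hk, if_pos (hgI k hk)]
      exact hg k hk
  have hsI (k) : k ∈ I ↔ s k ∉ I := by
    by_cases hk : k ∈ I
    · simp [s, hk, hfI k hk]
    · simp [s, hk, hgI k hk]
  refine ⟨hs.toPerm, ?_, fun i hi => ?_, hsI, fun k hk => if_pos hk⟩
  · ext k
    exact hs k
  · have := hsI i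
    rw [show s i = i from hi] at this
    tauto

theorem sum_single_eq_of_transversal {α : Type*} [Fintype α] [DecidableEq α] {I : Finset α}
    {σ : Equiv.Perm α} (hσ : σ * σ = 1) (hI : ∀ k, k ∈ I ↔ σ k ∉ I) :
    ∑ k ∈ I, (Finsupp.single k 1 + Finsupp.single (σ k) 1) =
      (∑ k, Finsupp.single k 1 : α →₀ ℕ) := by
  have hs := Equiv.Perm.apply_apply_of_mul_self hσ
  rw [Finset.sum_add_distrib, ← Finset.sum_add_sum_compl I]
  congr 1
  refine Finset.sum_bij' (fun k _ => σ k) (fun k _ => σ k) ?_ ?_ ?_ ?_ ?_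
  · intro k hk
    simpa using (hI k).1 hk
  · intro k hk
    have := hI k
    rw [Finset.mem_compl] at hk
    tauto
  all_goals simp [hs]

theorem coeff_prod_one_add_eq_hafnian {m : ℕ} {A : Matrix (Fin m) (Fin m) ℝ} (hA : Aᵀ = A) :
    (∏ k : Fin m, (1 + ∑ j, MvPolynomial.C (A k j / 2) * MvPolynomial.X k * MvPolynomial.X j) :
      MvPolynomial (Fin m) ℝ).coeff (∑ k, Finsupp.single k 1) = hafnian A := by
  classical
  have hmon (k j : Fin m) : (MvPolynomial.C (A k j / 2) * MvPolynomial.X k * MvPolynomial.X j :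
      MvPolynomial (Fin m) ℝ) =
      MvPolynomial.monomial (Finsupp.single k 1 + Finsupp.single j 1) (A k j / 2) := by
    rw [mul_assoc, MvPolynomial.X, MvPolynomial.X, MvPolynomial.monomial_mul,
      MvPolynomial.C_mul_monomial]
    simp
  have hhaf : hafnian A = ∑ σ : Equiv.Perm (Fin m) with σ * σ = 1 ∧ ∀ i, σ i ≠ i,
      ∑ I : Finset (Fin m) with ∀ k, k ∈ I ↔ σ k ∉ I, ∏ k ∈ I, (A k (σ k) / 2) := by
    unfold hafnian
    refine Finset.sum_congr (by congr) fun σ hσ => ?_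
    rw [Finset.mem_filter] at hσ
    exact (sum_prod_transversal hA hσ.2.1 hσ.2.2).symm
  rw [hhaf, Finset.prod_one_add, MvPolynomial.coeff_sum]
  simp_rw [hmon, Finset.prod_sum, ← MvPolynomial.monomial_sum_prod, MvPolynomial.coeff_sum,
    MvPolynomial.coeff_monomial]
  rw [Finset.sum_sigma', Finset.sum_sigma', ← Finset.sum_filter]
  symm
  refine Finset.sum_bij (fun p _ => ⟨p.2, fun k _ => p.1 k⟩) ?_ ?_ ?_ ?_
  · rintro ⟨σ, I⟩ h
    simp only [Finset.mem_sigma, Finset.mem_filter, Finset.mem_univ, true_and] at h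
    simp only [Finset.mem_filter, Finset.mem_sigma, Finset.mem_powerset, Finset.subset_univ,
      Finset.mem_pi, Finset.mem_univ, implies_true, and_self, true_and]
    rw [Finset.sum_attach I fun k => Finsupp.single k 1 + Finsupp.single (σ k) 1]
    exact sum_single_eq_of_transversal h.1.1 h.2
  · rintro ⟨σ, I⟩ h ⟨τ, J⟩ h' heq
    simp only [Finset.mem_sigma, Finset.mem_filter, Finset.mem_univ, true_and] at h h'
    obtain ⟨rfl, heq⟩ := Sigma.mk.inj_iff.1 heq
    have hστ (k) (hk : k ∈ I) : σ k = τ k := congrFun₂ (eq_of_heq heq) k hk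
    obtain rfl : σ = τ := by
      ext1 k
      by_cases hk : k ∈ I
      · exact hστ k hk
      · have hk' : σ k ∈ I := by_contra fun hn => hk ((h.2 k).2 hn)
        have h1 := hστ _ hk'
        rw [Equiv.Perm.apply_apply_of_mul_self h.1.1] at h1
        nth_rw 2 [h1]
        exact (Equiv.Perm.apply_apply_of_mul_self h'.1.1 _).symm
    rfl
  · rintro ⟨I, f⟩ h
    have h1 := (Finset.mem_filter.1 h).2
    dsimp only at h1
    have h2 : ∑ k ∈ I, (Finsupp.single k 1 +
        Finsupp.single (if hk : k ∈ I then f k hk else k) 1) =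
        (∑ k, Finsupp.single k 1 : Fin m →₀ ℕ) := by
      rw [← h1, ← Finset.sum_attach]
      simp
    obtain ⟨σ, hσ, hfix, hI, hσf⟩ := exists_perm_of_sum_single_eq h2
    refine ⟨⟨σ, I⟩, by simpa using ⟨⟨hσ, hfix⟩, hI⟩, ?_⟩
    simp only [Sigma.mk.injEq, heq_eq_eq, true_and]
    funext k hk
    rw [hσf k hk, dif_pos hk]
  · rintro ⟨σ, I⟩ -
    exact (Finset.prod_attach I fun k => A k (σ k) / 2).symm

theorem coeff_prod_one_add_submatrix {M N : ℕ} (A : Matrix (Fin M) (Fin M) ℝ) {β : Fin N → Fin M}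
    (hβ : Function.Injective β) :
    (∏ i, (1 + ∑ j, MvPolynomial.C (A i j / 2) * MvPolynomial.X i * MvPolynomial.X j) :
      MvPolynomial (Fin M) ℝ).coeff (∑ k, Finsupp.single (β k) 1) =
    (∏ i, (1 + ∑ j, MvPolynomial.C (A.submatrix β β i j / 2) * MvPolynomial.X i *
      MvPolynomial.X j) : MvPolynomial (Fin N) ℝ).coeff (∑ k, Finsupp.single k 1) := by
  have hX (k : Fin N) : MvPolynomial.killCompl hβ (MvPolynomial.X (β k)) =
      (MvPolynomial.X k : MvPolynomial (Fin N) ℝ) := by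
    rw [← MvPolynomial.rename_X, MvPolynomial.killCompl_rename_app]
  have hX0 (i : Fin M) (hi : i ∉ Set.range β) : MvPolynomial.killCompl hβ (MvPolynomial.X i) =
      (0 : MvPolynomial (Fin N) ℝ) := by
    rw [MvPolynomial.killCompl, MvPolynomial.aeval_X, dif_neg hi]
  have hs : (∑ k, Finsupp.single (β k) 1 : Fin M →₀ ℕ) =
      (∑ k, Finsupp.single k 1 : Fin N →₀ ℕ).mapDomain β := by
    simp [Finsupp.mapDomain_finsetSum, Finsupp.mapDomain_single]
  rw [hs, ← MvPolynomial.coeff_killCompl hβ]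
  congr 1
  simp only [map_prod, map_add, map_one, map_sum, map_mul, MvPolynomial.killCompl_C]
  symm
  refine Fintype.prod_of_injective β hβ _ _ (fun i hi => by simp [hX0 i hi]) fun k => ?_
  congr 1
  refine Fintype.sum_of_injective β hβ _ _ (fun i hi => by simp [hX0 i hi]) fun j => ?_
  simp [hX]

/-- **Proposition 2.** For real symmetric `M × M` matrices `S, R`, even `N ≤ M`, and
strictly increasing indices `β₁ < … < β_N`, the mixed partial derivative
`∂_{x_{β₁}} ⋯ ∂_{x_{β_N}}` at `x = 0` of
`x ↦ ∏_{i=1}^M (1 - ∑_m S_{im} R_{im} x_i x_m)^{-1/2}`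
equals the Hafnian of the `N × N` submatrix of the Hadamard product `S ∘ R`
on the rows and columns indexed by `β`. -/
theorem prop2_hafnian_derivative (M N : ℕ) (hNM : N ≤ M) (hN : Even N)
    (S R : Matrix (Fin M) (Fin M) ℝ) (hS : Sᵀ = S) (hR : Rᵀ = R)
    (β : Fin N → Fin M) (hβ : StrictMono β) :
    (iteratedFDeriv ℝ N
        (fun x : Fin M → ℝ =>
          ∏ i : Fin M, (1 - ∑ m : Fin M, S i m * R i m * x i * x m) ^ (-(1 : ℝ) / 2))
        0)
      (fun k => Pi.single (β k) (1 : ℝ)) =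
    hafnian ((S.hadamard R).submatrix β β) := by
  set A := S.hadamard R with hA
  have hAsymm : Aᵀ = A := by
    ext i j
    simp only [hA, transpose_apply, hadamard_apply]
    rw [← congrFun₂ hS i j, ← congrFun₂ hR i j, transpose_apply, transpose_apply]
  let l : Fin M → (Fin M → ℝ) → ℝ := fun i x => ∑ m, A i m * x m
  have hcoord (i : Fin M) : ContDiffAt ℝ ω (fun x : Fin M → ℝ => x i) 0 := contDiffAt_apply ..
  have hl (i) : ContDiffAt ℝ ω (l i) 0 :=
    ContDiffAt.sum fun m _ => contDiffAt_const.mul (hcoord m)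
  have hq (i) (x : Fin M → ℝ) : ∑ m, S i m * R i m * x i * x m = x i * l i x := by
    simp only [l, hA, hadamard_apply, Finset.mul_sum]
    exact Finset.sum_congr rfl fun m _ => by ring
  let s : Fin M → (Fin M → ℝ) → ℝ := fun i x => √(1 - x i * l i x)
  have hs (i) : ContDiffAt ℝ ω (s i) 0 :=
    (contDiffAt_const.sub ((hcoord i).mul (hl i))).sqrt (by simp)
  let h : Fin M → (Fin M → ℝ) → ℝ := fun i x =>
    l i x ^ 2 * ((2 + s i x) / (2 * s i x * (1 + s i x) ^ 2))
  have hh (i) : ContDiffAt ℝ ω (h i) 0 := by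
    refine ((hl i).pow 2).mul ((contDiffAt_const.add (hs i)).div
      ((contDiffAt_const.mul (hs i)).mul ((contDiffAt_const.add (hs i)).pow 2)) ?_)
    simp [s]
  let p : Fin M → MvPolynomial (Fin M) ℝ := fun i =>
    1 + ∑ j, MvPolynomial.C (A i j / 2) * MvPolynomial.X i * MvPolynomial.X j
  have hp (i) (x : Fin M → ℝ) : MvPolynomial.eval x (p i) = 1 + x i * l i x / 2 := by
    simp only [p, l, map_add, map_one, map_sum, map_mul, MvPolynomial.eval_C,
      MvPolynomial.eval_X, Finset.mul_sum, Finset.sum_div]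
    congr 1
    exact Finset.sum_congr rfl fun m _ => by ring
  have hF (i) : (fun x : Fin M → ℝ =>
      (1 - ∑ m : Fin M, S i m * R i m * x i * x m) ^ (-(1 : ℝ) / 2)) =ᶠ[𝓝 0]
      fun x => MvPolynomial.eval x (p i) + x i * (x i * h i x) := by
    have hlt : ∀ᶠ x in 𝓝 (0 : Fin M → ℝ), x i * l i x < 1 :=
      ((hcoord i).mul (hl i)).continuousAt.eventually_lt continuousAt_const (by simp)
    filter_upwards [hlt] with x hx
    rw [hq, one_sub_rpow_neg_half_eq hx, hp]
    simp only [h, s]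
    ring
  have key := iteratedFDeriv_prod_mul_eq_of_coord_sq hβ.injective
    (fun i => (contDiff_mvPolynomial_eval (p i)).contDiffAt) hh hF Finset.univ
    (G := fun _ => 1) contDiffAt_const
  simp only [mul_one] at key
  rw [key]
  simp_rw [← map_prod]
  rw [iteratedFDeriv_mvPolynomial_eval_zero hβ.injective,
    coeff_prod_one_add_submatrix A hβ.injective, coeff_prod_one_add_eq_hafnian]
  rw [transpose_submatrix, hAsymm]
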